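/- arXiv:1701.01318 — 2 statements merged into one kernel-verified Lean document; each statement's English description precedes it below -/
import Mathlib

section
/- Let Γ be a countable group, k ≥ 1, and let A : Γ → M_k(ℤ) be finitely supported and invertible in M_k(ℓ¹(Γ)). Define X_A = {x : Γ → (ℝ/ℤ)^k : for every h ∈ Γ and every j ∈ {1,…,k}, Σ_{g∈Γ} Σ_{i=1}^k A(g)_{j,i} · x(hg)_i = 0 in ℝ/ℤ} (a finite sum, using the ℤ-module structure of ℝ/ℤ); X_A is a closed shift-invariant subset of the compact metrizable space ((ℝ/ℤ)^k)^Γ, where the shift action of Γ is (γ·x)(h) = x(γ⁻¹h). Then, for any metric on X_A compatible with the product topology, the shift action of Γ on X_A is expansive and satisfies the pseudo-orbit tracing property. -/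
/-- Convolution by an inverse pair of summable families of operators recovers a bounded function. -/
theorem tsum_apply_tsum_eq_of_inverse {Γ E : Type*} [Group Γ] [NormedAddCommGroup E]
    [NormedSpace ℝ E] [CompleteSpace E] {P Q : Γ → E →L[ℝ] E}
    (hP : Summable fun g => ‖P g‖) (hQ : Summable fun g => ‖Q g‖)
    (hone : ∀ v, ∑' g, P g (Q (g⁻¹ * 1) v) = v)
    (hne : ∀ u, u ≠ 1 → ∀ v, ∑' g, P g (Q (g⁻¹ * u) v) = 0)
    {f : Γ → E} {M : ℝ} (hf : ∀ g, ‖f g‖ ≤ M) (h : Γ) :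
    ∑' g, P g (∑' u, Q u (f (h * g * u))) = f h := by
  have hM : 0 ≤ M := (norm_nonneg _).trans (hf 1)
  have hQf : ∀ g, Summable fun u => Q u (f (h * g * u)) := fun g =>
    Summable.of_norm_bounded (hQ.mul_right M) fun u =>
      (Q u).le_opNorm_of_le (hf _)
  have hPQ : Summable fun p : Γ × Γ => P p.1 (Q p.2 (f (h * p.1 * p.2))) := by
    refine Summable.of_norm_bounded ((Summable.mul_of_nonneg hP hQ (fun _ => norm_nonneg _)
      fun _ => norm_nonneg _).mul_right M) fun p => ?_
    rw [mul_assoc ‖P p.1‖]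
    exact (P p.1).le_opNorm_of_le ((Q p.2).le_opNorm_of_le (hf _))
  let e : Γ × Γ ≃ Γ × Γ := Equiv.prodShear (Equiv.refl Γ) fun g => Equiv.mulLeft g⁻¹
  have hPQ' : Summable fun p : Γ × Γ => P p.1 (Q (p.1⁻¹ * p.2) (f (h * p.2))) := by
    refine (e.summable_iff.mpr hPQ).congr fun p => ?_
    simp [e, mul_assoc]
  calc ∑' g, P g (∑' u, Q u (f (h * g * u)))
      = ∑' g, ∑' u, P g (Q (g⁻¹ * u) (f (h * u))) := by
        refine tsum_congr fun g => ?_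
        rw [(P g).map_tsum (hQf g), ← (Equiv.mulLeft g⁻¹).tsum_eq]
        simp [mul_assoc]
    _ = ∑' u, ∑' g, P g (Q (g⁻¹ * u) (f (h * u))) :=
        (Summable.tsum_comm (f := fun g u => P g (Q (g⁻¹ * u) (f (h * u)))) hPQ').symm
    _ = ∑' g, P g (Q (g⁻¹ * 1) (f (h * 1))) :=
        tsum_eq_single 1 fun u hu => hne u hu _
    _ = f h := by rw [hone, mul_one]

/-- Left multiplication by a real matrix, as a continuous linear map for the sup norm. -/
noncomputable def Matrix.mulVecCLM {k : ℕ} (M : Matrix (Fin k) (Fin k) ℝ) :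
    (Fin k → ℝ) →L[ℝ] (Fin k → ℝ) :=
  LinearMap.toContinuousLinearMap M.mulVecLin

theorem Matrix.mulVecCLM_apply {k : ℕ} (M : Matrix (Fin k) (Fin k) ℝ) (v : Fin k → ℝ) :
    M.mulVecCLM v = M.mulVec v := rfl

theorem Matrix.norm_mulVecCLM_le {k : ℕ} (M : Matrix (Fin k) (Fin k) ℝ) :
    ‖M.mulVecCLM‖ ≤ ∑ i, ∑ j, |M i j| := by
  have hnn : 0 ≤ ∑ i, ∑ j, |M i j| := by positivity
  refine ContinuousLinearMap.opNorm_le_bound _ hnn fun v => ?_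
  refine (pi_norm_le_iff_of_nonneg (by positivity)).mpr fun i => ?_
  calc ‖∑ j, M i j * v j‖ ≤ ∑ j, |M i j| * ‖v‖ := by
        refine norm_sum_le_of_le _ fun j _ => ?_
        rw [norm_mul, Real.norm_eq_abs]
        gcongr
        exact norm_le_pi_norm v j
    _ = (∑ j, |M i j|) * ‖v‖ := by rw [Finset.sum_mul]
    _ ≤ (∑ i, ∑ j, |M i j|) * ‖v‖ := by
        refine mul_le_mul_of_nonneg_right ?_ (norm_nonneg v)
        exact Finset.single_le_sum (f := fun i => ∑ j, |M i j|)
          (fun i _ => by positivity) (Finset.mem_univ i)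

/-- A convolution identity for matrices with finitely many nonzero terms, applied to a vector. -/
theorem tsum_mulVecCLM_mulVecCLM {Γ : Type*} [Group Γ] {k : ℕ}
    {P Q : Γ → Matrix (Fin k) (Fin k) ℝ} {u : Γ} {C : Matrix (Fin k) (Fin k) ℝ}
    (hfin : (Function.support fun h => P h * Q (h⁻¹ * u)).Finite)
    (hC : ∑ᶠ h, P h * Q (h⁻¹ * u) = C) (v : Fin k → ℝ) :
    ∑' g, (P g).mulVecCLM ((Q (g⁻¹ * u)).mulVecCLM v) = C.mulVec v := by
  simp only [Matrix.mulVecCLM_apply, Matrix.mulVec_mulVec]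
  rw [← hC, finsum_eq_sum _ hfin, Matrix.sum_mulVec]
  refine tsum_eq_sum fun g hg => ?_
  have : P g * Q (g⁻¹ * u) = 0 := by simpa using hg
  rw [this, Matrix.zero_mulVec]

/-- The operator attached to a matrix over the group ring supported in `s`. -/
def matrixConv {Γ G : Type*} [Group Γ] [AddCommGroup G] {k : ℕ} (s : Finset Γ)
    (A : Γ → Matrix (Fin k) (Fin k) ℤ) (x : Γ → Fin k → G) (h : Γ) (j : Fin k) : G :=
  ∑ g ∈ s, ∑ i, A g j i • x (h * g) i

section matrixConv

variable {Γ : Type*} [Group Γ] {k : ℕ} (s : Finset Γ) (A : Γ → Matrix (Fin k) (Fin k) ℤ)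

theorem matrixConv_sub {G : Type*} [AddCommGroup G] (x y : Γ → Fin k → G) :
    matrixConv s A (x - y) = matrixConv s A x - matrixConv s A y := by
  funext h j
  simp [matrixConv, smul_sub, Finset.sum_sub_distrib]

theorem matrixConv_map {G H : Type*} [AddCommGroup G] [AddCommGroup H] (φ : G →+ H)
    (x : Γ → Fin k → G) (h : Γ) (j : Fin k) :
    matrixConv s A (fun g i => φ (x g i)) h j = φ (matrixConv s A x h j) := by
  simp [matrixConv, map_sum, map_zsmul]

theorem norm_matrixConv_le {G : Type*} [NormedAddCommGroup G] {x : Γ → Fin k → G} {h : Γ} {η : ℝ}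
    (hx : ∀ g ∈ s, ∀ i, ‖x (h * g) i‖ ≤ η) (j : Fin k) :
    ‖matrixConv s A x h j‖ ≤ (∑ g ∈ s, ∑ j, ∑ i, |(A g j i : ℝ)|) * η := by
  rcases s.eq_empty_or_nonempty with rfl | ⟨g₀, hg₀⟩
  · simp [matrixConv]
  have hη : 0 ≤ η := (norm_nonneg _).trans (hx g₀ hg₀ j)
  rw [Finset.sum_mul]
  refine norm_sum_le_of_le _ fun g hg => ?_
  calc ‖∑ i, A g j i • x (h * g) i‖ ≤ ∑ i, |(A g j i : ℝ)| * η := by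
        refine norm_sum_le_of_le _ fun i _ => (norm_zsmul_le _ _).trans ?_
        rw [Int.norm_eq_abs]
        gcongr
        exact hx g hg i
    _ = (∑ i, |(A g j i : ℝ)|) * η := by rw [Finset.sum_mul]
    _ ≤ (∑ j, ∑ i, |(A g j i : ℝ)|) * η := by
        refine mul_le_mul_of_nonneg_right ?_ hη
        exact Finset.single_le_sum (f := fun j => ∑ i, |(A g j i : ℝ)|)
          (fun i _ => by positivity) (Finset.mem_univ j)

variable {s A}

theorem tsum_mulVecCLM_intCast (hs : ∀ g ∉ s, A g = 0) (f : Γ → Fin k → ℝ) (h : Γ) :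
    ∑' g, ((A g).map (fun z : ℤ => (z : ℝ))).mulVecCLM (f (h * g)) = matrixConv s A f h := by
  rw [tsum_eq_sum (s := s)]
  · funext j
    simp [matrixConv, Matrix.mulVecCLM_apply, Matrix.mulVec, dotProduct]
  · intro g hg
    ext j
    simp [hs g hg, Matrix.mulVecCLM_apply, Matrix.mulVec, dotProduct]

end matrixConv

theorem AddCircle.exists_coe_eq_abs_eq_norm (z : AddCircle (1 : ℝ)) :
    ∃ r : ℝ, (r : AddCircle (1 : ℝ)) = z ∧ |r| = ‖z‖ := by
  induction z using QuotientAddGroup.induction_on with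
  | H r =>
    refine ⟨r - round r, ?_, ?_⟩
    · have : ((round r : ℝ) : AddCircle (1 : ℝ)) = 0 :=
        (AddCircle.coe_eq_zero_iff 1).mpr ⟨round r, by simp⟩
      rw [AddCircle.coe_sub, this, sub_zero]
    · have := AddCircle.norm_eq (p := (1 : ℝ)) (x := r)
      simpa using this.symm

theorem AddCircle.norm_coe_le_abs (r : ℝ) : ‖(r : AddCircle (1 : ℝ))‖ ≤ |r| := by
  rw [AddCircle.norm_eq]
  simpa using round_le r 0

theorem summable_norm_mulVecCLM_intCast {Γ : Type*} {k : ℕ} {s : Finset Γ}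
    {A : Γ → Matrix (Fin k) (Fin k) ℤ} (hs : ∀ g ∉ s, A g = 0) :
    Summable fun g => ‖((A g).map (fun z : ℤ => (z : ℝ))).mulVecCLM‖ := by
  refine summable_of_ne_finset_zero (s := s) fun g hg => norm_eq_zero.mpr ?_
  ext v j
  simp [hs g hg, Matrix.mulVecCLM_apply, Matrix.mulVec, dotProduct]

theorem summable_norm_mulVecCLM {Γ : Type*} {k : ℕ} {B : Γ → Matrix (Fin k) (Fin k) ℝ}
    (hB : Summable fun g : Γ => ∑ i : Fin k, ∑ j : Fin k, |B g i j|) :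
    Summable fun g => ‖(B g).mulVecCLM‖ :=
  hB.of_nonneg_of_le (fun _ => norm_nonneg _) fun _ => Matrix.norm_mulVecCLM_le _

section AlgebraicAction

variable {Γ : Type*} [Group Γ] {k : ℕ} {s : Finset Γ} {A : Γ → Matrix (Fin k) (Fin k) ℤ}
  {B : Γ → Matrix (Fin k) (Fin k) ℝ}

open Classical in
/-- A point of the algebraic action that is uniformly close to zero vanishes. -/
theorem eq_zero_of_matrixConv_eq_zero (hs : ∀ g ∉ s, A g = 0)
    (hB : Summable fun g : Γ => ∑ i : Fin k, ∑ j : Fin k, |B g i j|)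
    (hBA : ∀ g : Γ, (∑ᶠ h : Γ, B h * (A (h⁻¹ * g)).map (fun z : ℤ => (z : ℝ))) =
      if g = 1 then (1 : Matrix (Fin k) (Fin k) ℝ) else 0)
    {η : ℝ} (hη₀ : 0 ≤ η) (hη : (∑ g ∈ s, ∑ j, ∑ i, |(A g j i : ℝ)|) * η < 1)
    {z : Γ → Fin k → AddCircle (1 : ℝ)} (hz : matrixConv s A z = 0)
    (hzη : ∀ h i, ‖z h i‖ ≤ η) : z = 0 := by
  choose f hfz hf using fun h i => AddCircle.exists_coe_eq_abs_eq_norm (z h i)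
  have hconv : matrixConv s A f = 0 := by
    funext h j
    have hcoe : ((matrixConv s A f h j : ℝ) : AddCircle (1 : ℝ)) = 0 := by
      have := matrixConv_map s A (QuotientAddGroup.mk' (AddSubgroup.zmultiples (1 : ℝ))) f h j
      rw [show (fun g i => QuotientAddGroup.mk' (AddSubgroup.zmultiples (1 : ℝ)) (f g i)) = z from
        funext fun g => funext fun i => hfz g i, hz] at this
      exact this.symm
    obtain ⟨n, hn⟩ := (AddCircle.coe_eq_zero_iff 1).mp hcoe
    have hlt : ‖matrixConv s A f h j‖ < 1 :=
      (norm_matrixConv_le s A (fun g _ i => (hf _ i).trans_le (hzη _ i)) j).trans_lt hη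
    have hn' : (n : ℝ) = matrixConv s A f h j := by simpa using hn
    rw [← hn', Real.norm_eq_abs] at hlt
    have hn0 : n = 0 := Int.abs_lt_one_iff.mp (by exact_mod_cast hlt)
    rw [← hn']
    simp [hn0]
  have hfin : ∀ u : Γ, (Function.support fun h =>
      B h * (A (h⁻¹ * u)).map (fun z : ℤ => (z : ℝ))).Finite := fun u => by
    refine (s.finite_toSet.image fun g => u * g⁻¹).subset fun h hh => ?_
    refine ⟨h⁻¹ * u, ?_, by group⟩
    by_contra hns
    refine hh ?_
    ext
    simp [hs _ hns, Matrix.mul_apply]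
  have hfη : ∀ g, ‖f g‖ ≤ η := fun g =>
    (pi_norm_le_iff_of_nonneg hη₀).mpr fun i => (hf g i).trans_le (hzη g i)
  let A' : Γ → Matrix (Fin k) (Fin k) ℝ := fun g => (A g).map (fun z : ℤ => (z : ℝ))
  have key := fun h => tsum_apply_tsum_eq_of_inverse (summable_norm_mulVecCLM hB)
    (summable_norm_mulVecCLM_intCast hs)
    (fun v => by simpa using tsum_mulVecCLM_mulVecCLM (Q := A') (hfin 1) (hBA 1) v)
    (fun u hu v => by simpa [hu] using tsum_mulVecCLM_mulVecCLM (Q := A') (hfin u) (hBA u) v)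
    hfη h
  funext h i
  have hf0 : f h = 0 := by
    rw [← key h]
    simp [tsum_mulVecCLM_intCast hs, hconv]
  rw [← hfz, hf0]
  simp

open Classical in
/-- A point nearly satisfying the defining equations is uniformly close to a solution. -/
theorem exists_matrixConv_eq_zero_near (hs : ∀ g ∉ s, A g = 0)
    (hB : Summable fun g : Γ => ∑ i : Fin k, ∑ j : Fin k, |B g i j|)
    (hAB : ∀ g : Γ, (∑ᶠ h : Γ, (A h).map (fun z : ℤ => (z : ℝ)) * B (h⁻¹ * g)) =
      if g = 1 then (1 : Matrix (Fin k) (Fin k) ℝ) else 0)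
    {η : ℝ} (hη : 0 ≤ η) {x : Γ → Fin k → AddCircle (1 : ℝ)}
    (hx : ∀ h j, ‖matrixConv s A x h j‖ ≤ η) :
    ∃ y : Γ → Fin k → AddCircle (1 : ℝ), matrixConv s A y = 0 ∧
      ∀ h i, ‖y h i - x h i‖ ≤ (∑' g, ‖(B g).mulVecCLM‖) * η := by
  choose e hex he using fun h j => AddCircle.exists_coe_eq_abs_eq_norm (matrixConv s A x h j)
  have heη : ∀ h, ‖e h‖ ≤ η := fun h =>
    (pi_norm_le_iff_of_nonneg hη).mpr fun j => (he h j).trans_le (hx h j)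
  have hfin : ∀ u : Γ, (Function.support fun h =>
      (A h).map (fun z : ℤ => (z : ℝ)) * B (h⁻¹ * u)).Finite := fun u => by
    refine s.finite_toSet.subset fun h hh => ?_
    by_contra hns
    refine hh ?_
    ext
    simp [hs _ hns, Matrix.mul_apply]
  have hBn := summable_norm_mulVecCLM hB
  let w : Γ → Fin k → ℝ := fun h => ∑' u, (B u).mulVecCLM (e (h * u))
  have hw : matrixConv s A w = e := by
    funext h
    rw [← tsum_mulVecCLM_intCast hs]
    exact tsum_apply_tsum_eq_of_inverse (summable_norm_mulVecCLM_intCast hs) hBn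
      (fun v => by simpa using tsum_mulVecCLM_mulVecCLM (hfin 1) (hAB 1) v)
      (fun u hu v => by simpa [hu] using tsum_mulVecCLM_mulVecCLM (hfin u) (hAB u) v) heη h
  have hwη : ∀ h, ‖w h‖ ≤ (∑' g, ‖(B g).mulVecCLM‖) * η := fun h =>
    tsum_of_norm_bounded (hBn.hasSum.mul_right η) fun u =>
      (B u).mulVecCLM.le_opNorm_of_le (heη _)
  refine ⟨x - fun h i => (w h i : AddCircle (1 : ℝ)), ?_, fun h i => ?_⟩
  · rw [matrixConv_sub, sub_eq_zero]
    funext h j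
    have := matrixConv_map s A (QuotientAddGroup.mk' (AddSubgroup.zmultiples (1 : ℝ))) w h j
    rw [hw] at this
    exact (hex h j).symm.trans this.symm
  · rw [Pi.sub_apply, Pi.sub_apply, sub_sub_cancel_left, norm_neg]
    exact (AddCircle.norm_coe_le_abs _).trans ((norm_le_pi_norm (w h) i).trans (hwη h))

theorem continuous_matrixConv (h : Γ) (j : Fin k) :
    Continuous fun x : Γ → Fin k → AddCircle (1 : ℝ) => matrixConv s A x h j := by
  unfold matrixConv
  fun_prop

end AlgebraicAction

/-- A compatible metric on a compact subset of a product is controlled by finitely many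
coordinates. -/
theorem exists_finset_dist_lt_of_isCompact {ι Y : Type*} [MetricSpace Y] {X : Set (ι → Y)}
    (hX : IsCompact X) (dX : MetricSpace X)
    (hdX : dX.toUniformSpace.toTopologicalSpace = (inferInstance : TopologicalSpace X))
    {ε : ℝ} (hε : 0 < ε) :
    ∃ (F : Finset ι) (η : ℝ), 0 < η ∧ ∀ x y : X,
      (∀ i ∈ F, dist (x.1 i) (y.1 i) < η) → dX.dist x y < ε := by
  have : CompactSpace X := isCompact_iff_compactSpace.mp hX
  have hu : dX.toUniformSpace = instUniformSpaceSubtype := unique_uniformity_of_compact hdX rfl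
  have hmem : {p : X × X | dX.dist p.1 p.2 < ε} ∈ @uniformity X instUniformSpaceSubtype := by
    rw [← hu]
    exact @Metric.dist_mem_uniformity X dX.toPseudoMetricSpace ε hε
  rw [uniformity_subtype, Pi.uniformity, Filter.mem_comap] at hmem
  obtain ⟨V, hV, hVsub⟩ := hmem
  obtain ⟨⟨F, η⟩, ⟨hF, hη⟩, hsub⟩ := (Filter.HasBasis.iInf' fun i =>
    (Metric.uniformity_basis_dist (α := Y)).comap fun p : (ι → Y) × (ι → Y) =>
      (p.1 i, p.2 i)).mem_iff.mp hV
  obtain ⟨η₀, hη₀, hle⟩ : ∃ η₀ : ℝ, 0 < η₀ ∧ ∀ i ∈ F, η₀ ≤ η i := by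
    rcases hF.toFinset.eq_empty_or_nonempty with hF0 | hF1
    · exact ⟨1, one_pos, fun i hi => by simp [← hF.mem_toFinset, hF0] at hi⟩
    · obtain ⟨i₀, hi₀, hmin⟩ := hF.toFinset.exists_min_image η hF1
      exact ⟨η i₀, hη i₀ (hF.mem_toFinset.mp hi₀), fun i hi => hmin i (hF.mem_toFinset.mpr hi)⟩
  refine ⟨hF.toFinset, η₀, hη₀, fun x y hxy => ?_⟩
  suffices h : (x.1, y.1) ∈ V from @hVsub (x, y) h
  refine hsub ?_
  simp only [Set.mem_iInter]
  exact fun i hi => (hxy i (hF.mem_toFinset.mpr hi)).trans_le (hle i hi)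

theorem exists_dist_lt_of_isCompact {ι Y : Type*} [MetricSpace Y] {X : Set (ι → Y)}
    (hX : IsCompact X) (dX : MetricSpace X)
    (hdX : dX.toUniformSpace.toTopologicalSpace = (inferInstance : TopologicalSpace X))
    (i : ι) {η : ℝ} (hη : 0 < η) :
    ∃ δ : ℝ, 0 < δ ∧ ∀ x y : X, dX.dist x y < δ → dist (x.1 i) (y.1 i) < η := by
  have : CompactSpace X := isCompact_iff_compactSpace.mp hX
  have hu : dX.toUniformSpace = instUniformSpaceSubtype := unique_uniformity_of_compact hdX rfl
  have hmem : {p : X × X | dist (p.1.1 i) (p.2.1 i) < η} ∈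
      @uniformity X instUniformSpaceSubtype :=
    ((Pi.uniformContinuous_proj (fun _ : ι => Y) i).comp
      (uniformContinuous_subtype_val (p := (· ∈ X)))) (Metric.dist_mem_uniformity hη)
  rw [← hu] at hmem
  obtain ⟨δ, hδ, hsub⟩ := (@Metric.mem_uniformity_dist X dX.toPseudoMetricSpace _).mp hmem
  exact ⟨δ, hδ, fun x y hxy => hsub hxy⟩

open Classical in
theorem expansive_pot_of_invertible_matrix_action
    {Γ : Type*} [Group Γ] [Countable Γ] {k : ℕ} (hk : 1 ≤ k)
    -- `A ∈ M_k(ℤΓ)`, finitely supported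
    (A : Γ → Matrix (Fin k) (Fin k) ℤ) (hA : (Function.support A).Finite)
    -- `A` is invertible in `M_k(ℓ¹(Γ))`, with inverse `B`
    (B : Γ → Matrix (Fin k) (Fin k) ℝ)
    (hB : Summable fun g : Γ => ∑ i : Fin k, ∑ j : Fin k, |B g i j|)
    (hAB : ∀ g : Γ, (∑ᶠ h : Γ, (A h).map (fun z : ℤ => (z : ℝ)) * B (h⁻¹ * g)) =
      if g = 1 then (1 : Matrix (Fin k) (Fin k) ℝ) else 0)
    (hBA : ∀ g : Γ, (∑ᶠ h : Γ, B h * (A (h⁻¹ * g)).map (fun z : ℤ => (z : ℝ))) =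
      if g = 1 then (1 : Matrix (Fin k) (Fin k) ℝ) else 0)
    -- the algebraic action `X_A`
    (XA : Set (Γ → Fin k → AddCircle (1 : ℝ)))
    (hXA : XA = {x | ∀ (h : Γ) (j : Fin k),
      (∑ᶠ g : Γ, ∑ i : Fin k, A g j i • x (h * g) i) = 0})
    -- `X_A` is invariant under the shift `(γ · x)(h) = x (γ⁻¹ h)`
    (hshift : ∀ γ : Γ, ∀ x ∈ XA, (fun h : Γ => x (γ⁻¹ * h)) ∈ XA)
    -- an arbitrary metric on `X_A` compatible with the product topology
    (dX : MetricSpace ↥XA)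
    (hdX : dX.toUniformSpace.toTopologicalSpace = (inferInstance : TopologicalSpace ↥XA)) :
    -- the shift action on `X_A` is expansive ...
    (∃ c : ℝ, 0 < c ∧ ∀ x y : ↥XA,
      (∀ γ : Γ, dX.dist ⟨fun h : Γ => (x : Γ → Fin k → AddCircle (1 : ℝ)) (γ⁻¹ * h),
          hshift γ x.1 x.2⟩
        ⟨fun h : Γ => (y : Γ → Fin k → AddCircle (1 : ℝ)) (γ⁻¹ * h), hshift γ y.1 y.2⟩ ≤ c) →
      x = y) ∧
    -- ... and satisfies the pseudo-orbit tracing property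
    (∀ ε : ℝ, 0 < ε → ∃ (S : Finset Γ) (δ : ℝ), 0 < δ ∧
      ∀ o : Γ → ↥XA,
        (∀ s ∈ S, ∀ g : Γ,
          dX.dist ⟨fun h : Γ => (o g : Γ → Fin k → AddCircle (1 : ℝ)) (s⁻¹ * h),
            hshift s (o g).1 (o g).2⟩ (o (s * g)) < δ) →
        ∃ y : ↥XA, ∀ g : Γ,
          dX.dist ⟨fun h : Γ => (y : Γ → Fin k → AddCircle (1 : ℝ)) (g⁻¹ * h),
            hshift g y.1 y.2⟩ (o g) < ε) := by
  set s : Finset Γ := hA.toFinset with hs_def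
  have hs : ∀ g ∉ s, A g = 0 := fun g hg => by simpa [hs_def] using hg
  have hfs : ∀ (x : Γ → Fin k → AddCircle (1 : ℝ)) (h : Γ) (j : Fin k),
      ∑ᶠ g : Γ, ∑ i : Fin k, A g j i • x (h * g) i = matrixConv s A x h j := fun x h j =>
    finsum_eq_sum_of_support_subset _ fun g hg => by
      by_contra hns
      exact hg (by simp [hs g hns])
  have hmem : ∀ x, x ∈ XA ↔ matrixConv s A x = 0 := fun x => by
    rw [hXA]
    simp only [Set.mem_ofPred_eq, hfs, funext_iff, Pi.zero_apply]
  have hcompact : IsCompact XA := by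
    refine IsClosed.isCompact ?_
    have : XA = ⋂ (h : Γ) (j : Fin k), {x | matrixConv s A x h j = 0} := by
      ext x
      simp [hmem, funext_iff]
    rw [this]
    exact isClosed_iInter fun h => isClosed_iInter fun j =>
      isClosed_singleton.preimage (continuous_matrixConv h j)
  set K : ℝ := ∑ g ∈ s, ∑ j, ∑ i, |(A g j i : ℝ)|
  have hK0 : 0 ≤ K := by positivity
  set N : ℝ := ∑' g, ‖(B g).mulVecCLM‖
  have hN0 : 0 ≤ N := tsum_nonneg fun _ => norm_nonneg _
  refine ⟨?_, fun ε hε => ?_⟩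
  · obtain ⟨δ, hδ, hδX⟩ := exists_dist_lt_of_isCompact hcompact dX hdX 1
      (η := (K + 1)⁻¹) (by positivity)
    refine ⟨δ / 2, half_pos hδ, fun x y hxy => ?_⟩
    have hz : x.1 - y.1 = 0 := by
      refine eq_zero_of_matrixConv_eq_zero hs hB hBA (η := (K + 1)⁻¹) (by positivity) ?_ ?_ fun h i => ?_
      · rw [← div_eq_mul_inv, div_lt_one (by positivity)]
        linarith
      · rw [matrixConv_sub, (hmem _).mp x.2, (hmem _).mp y.2, sub_zero]
      · have := hδX _ _ ((hxy h⁻¹).trans_lt (half_lt_self hδ))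
        simp only [inv_inv, mul_one] at this
        rw [Pi.sub_apply, Pi.sub_apply, ← dist_eq_norm]
        exact (dist_le_pi_dist _ _ i).trans this.le
    exact Subtype.ext (sub_eq_zero.mp hz)
  · obtain ⟨F, η, hη, hFη⟩ := exists_finset_dist_lt_of_isCompact hcompact dX hdX hε
    set θ : ℝ := η / (2 * (N * K + 1)) with hθ_def
    have hθ : 0 < θ := by positivity
    have hθη : N * (K * θ) + θ < η := by
      have : (N * K + 1) * θ = η / 2 := by
        rw [hθ_def]
        field_simp
      linarith
    obtain ⟨δ, hδ, hδX⟩ := exists_dist_lt_of_isCompact hcompact dX hdX 1 hθ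
    refine ⟨(F ∪ s).image (·⁻¹), δ, hδ, fun o ho => ?_⟩
    have hclose : ∀ h ∈ F ∪ s, ∀ g, dist ((o g).1 h) ((o (h⁻¹ * g)).1 1) < θ := fun h hh g => by
      simpa using hδX _ _ (ho h⁻¹ (Finset.mem_image_of_mem _ hh) g)
    let x : Γ → Fin k → AddCircle (1 : ℝ) := fun g => (o g⁻¹).1 1
    obtain ⟨y, hy, hyx⟩ := exists_matrixConv_eq_zero_near (x := x) hs hB hAB
      (η := K * θ) (by positivity) fun h j => by
        let z : Γ → Fin k → AddCircle (1 : ℝ) := fun g => (o h⁻¹).1 (h⁻¹ * g)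
        have hz : matrixConv s A z = 0 := (hmem _).mp (hshift h _ (o h⁻¹).2)
        have hxz : matrixConv s A x = matrixConv s A (x - z) := by
          rw [matrixConv_sub, hz, sub_zero]
        rw [hxz]
        refine norm_matrixConv_le s A (fun g hg i => ?_) j
        rw [Pi.sub_apply, Pi.sub_apply, ← dist_eq_norm, dist_comm]
        refine (dist_le_pi_dist _ _ i).trans (le_of_lt ?_)
        simpa [x, z] using hclose g (Finset.mem_union_right _ hg) h⁻¹
    refine ⟨⟨y, (hmem y).mpr hy⟩, fun g => hFη _ _ fun h hh => ?_⟩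
    have hyx' : dist (y (g⁻¹ * h)) (x (g⁻¹ * h)) ≤ N * (K * θ) :=
      (dist_pi_le_iff (by positivity)).mpr fun i => by
        rw [dist_eq_norm]
        exact hyx _ i
    have hxo : dist (x (g⁻¹ * h)) ((o g).1 h) < θ := by
      rw [dist_comm]
      simpa [x] using hclose h (Finset.mem_union_left _ hh) g
    exact (dist_triangle _ _ _).trans_lt ((add_lt_add_of_le_of_lt hyx' hxo).trans hθη)
end

section
/- With the setup of the context, for every n ≥ 1 one has X_{n+1} ⊆ X_n. -/
/-- The combinatorial setup of Section 5: a chain of finite-index normal subgroups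
`Γs n` of `Γ` with `Γs 0 = Γ`, transversals `T n` of `Γs n` in `Γs (n-1)`, the fundamental
domains `E n = T n · E (n-1)` (with `E 0 = {1}`), and inductively chosen pattern sets
`A n ⊆ (ℤ/3ℤ)^{E n}` with distinguished patterns `w n ∈ A n` and sum-patterns `s n`,
such that every `v ∈ A n` restricts to `w (n-1)` on `E (n-1)`, its translate by every
`t ∈ T n \ {1}` lies in `A (n-1) \ {w (n-1)}`, and the sum of all its `T n`-translates
equals `s (n-1)`. -/
structure SubshiftSetup (Γ : Type*) [Group Γ] where
  Γs : ℕ → Subgroup Γ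
  Γs_zero : Γs 0 = ⊤
  Γs_antitone : ∀ n : ℕ, Γs (n + 1) ≤ Γs n
  Γs_normal : ∀ n : ℕ, (Γs n).Normal
  Γs_finiteIndex : ∀ n : ℕ, (Γs n).FiniteIndex
  T : ℕ → Finset Γ
  one_mem_T : ∀ n : ℕ, 1 ≤ n → (1 : Γ) ∈ T n
  T_subset : ∀ n : ℕ, 1 ≤ n → ∀ t ∈ T n, t ∈ Γs (n - 1)
  T_coset : ∀ n : ℕ, 1 ≤ n → ∀ g ∈ Γs (n - 1), ∃! t : Γ, t ∈ T n ∧ g * t⁻¹ ∈ Γs n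
  E : ℕ → Finset Γ
  E_zero : E 0 = {1}
  E_succ : ∀ n : ℕ, 1 ≤ n → ∀ g : Γ, g ∈ E n ↔ ∃ t ∈ T n, ∃ e ∈ E (n - 1), g = t * e
  mul_mem_E : ∀ n : ℕ, 1 ≤ n → ∀ t ∈ T n, ∀ f ∈ E (n - 1), t * f ∈ E n
  A : (n : ℕ) → Set ({x : Γ // x ∈ E n} → ZMod 3)
  w : (n : ℕ) → {x : Γ // x ∈ E n} → ZMod 3
  s : (n : ℕ) → {x : Γ // x ∈ E n} → ZMod 3
  w_mem_A : ∀ n : ℕ, w n ∈ A n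
  A_zero : A 0 = Set.univ
  A_restrict : ∀ (n : ℕ) (hn : 1 ≤ n), ∀ v ∈ A n,
    (fun f : {x : Γ // x ∈ E (n - 1)} =>
      v ⟨(1 : Γ) * f.1, mul_mem_E n hn 1 (one_mem_T n hn) f.1 f.2⟩) = w (n - 1)
  A_translate : ∀ (n : ℕ) (hn : 1 ≤ n), ∀ v ∈ A n, ∀ (t : Γ) (ht : t ∈ T n), t ≠ 1 →
    (fun f : {x : Γ // x ∈ E (n - 1)} =>
      v ⟨t * f.1, mul_mem_E n hn t ht f.1 f.2⟩) ∈ A (n - 1) ∧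
    (fun f : {x : Γ // x ∈ E (n - 1)} =>
      v ⟨t * f.1, mul_mem_E n hn t ht f.1 f.2⟩) ≠ w (n - 1)
  A_sum : ∀ (n : ℕ) (hn : 1 ≤ n), ∀ v ∈ A n, ∀ f : {x : Γ // x ∈ E (n - 1)},
    ∑ t ∈ (T n).attach, v ⟨t.1 * f.1, mul_mem_E n hn t.1 t.2 f.1 f.2⟩ = s (n - 1) f

variable {Γ : Type*} [Group Γ]

/-- The set `R n`: points `x : Γ → ℤ/3ℤ` such that for every `g ∈ Γs n` the pattern
`f ↦ x (g * f)` on `E n` belongs to `A n`. -/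
def SubshiftSetup.R (S : SubshiftSetup Γ) (n : ℕ) : Set (Γ → ZMod 3) :=
  {x | ∀ g ∈ S.Γs n, (fun f : {y : Γ // y ∈ S.E n} => x (g * f.1)) ∈ S.A n}

/-- The set `X n`: points `x` such that `h ↦ x (g * h)` belongs to `R n` for some `g ∈ E n`. -/
def SubshiftSetup.Xn (S : SubshiftSetup Γ) (n : ℕ) : Set (Γ → ZMod 3) :=
  {x | ∃ g ∈ S.E n, (fun h : Γ => x (g * h)) ∈ S.R n}

namespace SubshiftSetup

/-- Every translate of a pattern in `A (n + 1)` by an element of `T (n + 1)` lies in `A n`. -/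
theorem translate_mem_A (S : SubshiftSetup Γ) (n : ℕ) {v : {x : Γ // x ∈ S.E (n + 1)} → ZMod 3}
    (hv : v ∈ S.A (n + 1)) {t : Γ} (ht : t ∈ S.T (n + 1)) :
    (fun f : {x : Γ // x ∈ S.E n} =>
      v ⟨t * f.1, S.mul_mem_E (n + 1) n.succ_pos t ht f.1 f.2⟩) ∈ S.A n := by
  by_cases h : t = 1
  · subst h
    exact (S.A_restrict (n + 1) n.succ_pos v hv).symm ▸ S.w_mem_A n
  · exact (S.A_translate (n + 1) n.succ_pos v hv t ht h).1

theorem R_succ_subset_R (S : SubshiftSetup Γ) (n : ℕ) : S.R (n + 1) ⊆ S.R n := by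
  intro x hx g hg
  obtain ⟨t, ⟨ht, hgt⟩, -⟩ := S.T_coset (n + 1) n.succ_pos g hg
  simpa [← mul_assoc] using S.translate_mem_A n (hx _ hgt) ht

theorem comp_mul_left_mem_R (S : SubshiftSetup Γ) {n : ℕ} {x : Γ → ZMod 3} (hx : x ∈ S.R n)
    {g : Γ} (hg : g ∈ S.Γs n) : (fun h => x (g * h)) ∈ S.R n := by
  intro k hk
  simpa only [mul_assoc] using hx (g * k) (mul_mem hg hk)

end SubshiftSetup

theorem Xn_succ_subset_Xn (S : SubshiftSetup Γ) (n : ℕ) (hn : 1 ≤ n) :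
    S.Xn (n + 1) ⊆ S.Xn n := by
  rintro x ⟨g, hg, hx⟩
  obtain ⟨t, ht, e, he, rfl⟩ := (S.E_succ (n + 1) n.succ_pos g).1 hg
  have htn : t⁻¹ ∈ S.Γs n := inv_mem (S.T_subset (n + 1) n.succ_pos t ht)
  have hconj : e⁻¹ * t⁻¹ * e ∈ S.Γs n := by
    simpa using (S.Γs_normal n).conj_mem _ htn e⁻¹
  refine ⟨e, he, ?_⟩
  simpa [mul_assoc] using S.comp_mul_left_mem_R (S.R_succ_subset_R n hx) hconj
end
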